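/- Let δ ∈ [0, 1/2) be rational, let t_1,…,t_{n−1} be integers, set t_n = −Σ_{i=1}^{n−1} t_i (so Σ_{i=1}^n t_i = 0), let c = −(min_i t_i)/(1/2+δ), a_i = t_i + (1/2+δ)·c, b_i = c − a_i. Then the following are equivalent: (i) there exists a nonempty subset W ⊆ {1,…,n−1} with Σ_{i∈W} t_i = 0; (ii) there exists a partition of {1,…,n} into nonempty proper subsets S_1, S_2 with Σ_{i∈S_k} a_i = (1/2+δ)·Σ_{i∈S_k}(a_i+b_i) for k = 1, 2. -/

import Mathlib

/-- Theorem 3 (FPSP Hardness), mathematical content of the reduction: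
given integers `t 1, …, t (n-1)` (here indexed by `Fin n` via `Fin.castSucc`)
and the balancing entry `t n = -∑_{i<n} t i` (here `t (Fin.last n)`), with
`c = -(min_i t i)/(1/2+δ)`, `a i = t i + (1/2+δ)·c`, `b i = c - a i`,
the Subset Sum instance has a nonempty zero-sum subset of the first `n-1`
entries iff the FPSP(δ) instance has a solution, i.e. a partition of all
indices into nonempty proper subsets each with type-A proportion `1/2+δ`. -/
theorem subsetSum_iff_fpsp (n : ℕ) (δ : ℚ) (hδ0 : 0 ≤ δ) (hδ1 : δ < 1/2)
    (t : Fin (n+1) → ℤ)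
    (hlast : t (Fin.last n) = -∑ i : Fin n, t i.castSucc)
    (m : ℤ) (hm_le : ∀ i, m ≤ t i) (hm_mem : ∃ i, t i = m)
    (c : ℚ) (hc : c = -(m : ℚ) / (1/2 + δ))
    (a b : Fin (n+1) → ℚ)
    (ha : ∀ i, a i = (t i : ℚ) + (1/2 + δ) * c)
    (hb : ∀ i, b i = c - a i) :
    (∃ W : Finset (Fin n), W.Nonempty ∧ ∑ i ∈ W, t i.castSucc = 0) ↔
    (∃ S₁ S₂ : Finset (Fin (n+1)), S₁.Nonempty ∧ S₂.Nonempty ∧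
      Disjoint S₁ S₂ ∧ S₁ ∪ S₂ = Finset.univ ∧
      (∑ i ∈ S₁, a i = (1/2 + δ) * ∑ i ∈ S₁, (a i + b i)) ∧
      (∑ i ∈ S₂, a i = (1/2 + δ) * ∑ i ∈ S₂, (a i + b i))) := by
  have key : ∀ S : Finset (Fin (n+1)),
      (∑ i ∈ S, a i = (1/2 + δ) * ∑ i ∈ S, (a i + b i)) ↔ ∑ i ∈ S, t i = 0 := by
    intro S
    have h1 : ∑ i ∈ S, a i = ((∑ i ∈ S, t i : ℤ) : ℚ) + S.card * ((1/2 + δ) * c) := by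
      simp only [ha, Finset.sum_add_distrib, Finset.sum_const, nsmul_eq_mul]
      push_cast
      ring
    have h2 : ∑ i ∈ S, (a i + b i) = S.card * c := by
      simp only [hb, add_sub_cancel, Finset.sum_const, nsmul_eq_mul]
    rw [h1, h2, ← Int.cast_eq_zero (α := ℚ)]
    constructor <;> intro h <;> linarith
  have back : ∀ S : Finset (Fin (n+1)), S.Nonempty → Fin.last n ∉ S → ∑ i ∈ S, t i = 0 →
      ∃ W : Finset (Fin n), W.Nonempty ∧ ∑ i ∈ W, t i.castSucc = 0 := by
    intro S hS hl h0
    have hmap : (Finset.univ.filter (fun i : Fin n => i.castSucc ∈ S)).map Fin.castSuccEmb = S := by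
      ext x
      simp only [Finset.mem_map, Finset.mem_filter, Finset.mem_univ, true_and,
        Fin.coe_castSuccEmb]
      constructor
      · rintro ⟨y, hy, rfl⟩
        exact hy
      · intro hx
        have hne : x ≠ Fin.last n := fun h => hl (h ▸ hx)
        obtain ⟨y, rfl⟩ := Fin.exists_castSucc_eq.mpr hne
        exact ⟨y, hx, rfl⟩
    refine ⟨Finset.univ.filter (fun i : Fin n => i.castSucc ∈ S), ?_, ?_⟩
    · rw [← hmap] at hS
      exact Finset.map_nonempty.mp hS
    · rw [← hmap, Finset.sum_map] at h0
      exact h0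
  constructor
  · rintro ⟨W, hW, h0⟩
    have hs : ∑ i ∈ W.map Fin.castSuccEmb, t i = 0 := by
      rw [Finset.sum_map]
      exact h0
    refine ⟨W.map Fin.castSuccEmb, (W.map Fin.castSuccEmb)ᶜ, hW.map, ⟨Fin.last n, ?_⟩,
      disjoint_compl_right, Finset.union_compl _, (key _).2 hs, (key _).2 ?_⟩
    · simp only [Finset.mem_compl, Finset.mem_map, Fin.coe_castSuccEmb, not_exists, not_and]
      intro x _
      exact Fin.castSucc_ne_last x
    · have h1 := Finset.sum_add_sum_compl (W.map Fin.castSuccEmb) t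
      rw [Fin.sum_univ_castSucc, hlast] at h1
      linarith
  · rintro ⟨S₁, S₂, hS₁, hS₂, hd, -, h1, h2⟩
    rw [key] at h1 h2
    by_cases hl : Fin.last n ∈ S₁
    · exact back S₂ hS₂ (Finset.disjoint_left.mp hd hl) h2
    · exact back S₁ hS₁ hl h1
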